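/- Let m ≥ 1, let α be a primitive element of 𝔽_{2^m}, let t be a positive divisor of 2^m − 1, and set l = (2^m − 1)/t. Suppose S = Σ_{μ=1}^{l−1} (α^{μt} + 1)^{−1} = 0 in 𝔽_{2^m}. Let L = {a ∈ 𝔽_{2^m} : a ≠ 0 and a^t ≠ 1} (so |L| = 2^m − t − 1). Then Σ_{a ∈ L} (z − a)^{−1} = 0 in the quotient ring 𝔽_{2^m}[z]/(z^t + 1); equivalently, the all-ones vector of length 2^m − t − 1 is a codeword of the binary Goppa code Γ(L, z^t + 1). -/

import Mathlib

open Polynomial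

/-- An element whose powers exhaust the nonzero elements of a finite field is a primitive root. -/
theorem isPrimitiveRoot_of_forall_eq_pow {F : Type*} [Field F] [Fintype F] {α : F}
    (h0 : α ≠ 0) (hα : ∀ x : F, x ≠ 0 → ∃ k : ℕ, x = α ^ k) :
    IsPrimitiveRoot α (Fintype.card F - 1) := by
  classical
  have h : orderOf (Units.mk0 α h0) = Fintype.card F - 1 := by
    rw [← Fintype.card_units, ← Nat.card_eq_fintype_card]
    refine orderOf_eq_card_of_forall_mem_zpowers fun u => ?_
    obtain ⟨k, hk⟩ := hα u u.ne_zero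
    exact ⟨k, by ext; simp [hk]⟩
  simpa [h] using (IsPrimitiveRoot.orderOf (Units.mk0 α h0)).map_of_injective
    (f := Units.coeHom F) Units.val_injective

theorem sum_range_mul_of_periodic {M : Type*} [AddCommMonoid M] {f : ℕ → M} {l : ℕ}
    (hf : Function.Periodic f l) (t : ℕ) :
    ∑ k ∈ Finset.range (l * t), f k = t • ∑ k ∈ Finset.range l, f k := by
  induction t with
  | zero => simp
  | succ s ih =>
    rw [Nat.mul_succ, Finset.sum_range_add, ih, succ_nsmul]
    congr 1
    refine Finset.sum_congr rfl fun k _ => ?_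
    rw [add_comm, mul_comm]
    exact hf.nat_mul s k

/-- Summing over the nonzero elements of a finite field along the powers of a primitive root. -/
theorem sum_ne_zero_eq_sum_range_pow {F M : Type*} [Field F] [Fintype F] [DecidableEq F]
    [AddCommMonoid M] {α : F} (hα : IsPrimitiveRoot α (Fintype.card F - 1)) (f : F → M) :
    ∑ a with a ≠ 0, f a = ∑ k ∈ Finset.range (Fintype.card F - 1), f (α ^ k) := by
  have hc : 1 < Fintype.card F := Fintype.one_lt_card
  have hinj : Set.InjOn (fun k => α ^ k) (Finset.range (Fintype.card F - 1)) := by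
    intro i hi j hj h
    exact hα.pow_inj (by simpa using hi) (by simpa using hj) h
  have himg : (Finset.range (Fintype.card F - 1)).image (fun k => α ^ k)
      = Finset.univ.filter (fun a : F => a ≠ 0) := by
    refine Finset.eq_of_subset_of_card_le ?_ ?_
    · intro a ha
      obtain ⟨k, -, rfl⟩ := Finset.mem_image.1 ha
      simpa using fun h => absurd h (hα.ne_zero (by omega))
    · rw [Finset.card_image_of_injOn hinj, Finset.filter_ne' Finset.univ (0 : F)]
      simp [Finset.card_erase_of_mem]
  rw [← himg, Finset.sum_image hinj]

/-- Sums of `a ^ j * g (a ^ t)` vanish for `0 < j < t`, by the substitution `a ↦ ω * a`. -/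
theorem sum_pow_mul_eq_zero {F : Type*} [Field F] [Fintype F] {ω : F} {t j : ℕ}
    (hω : IsPrimitiveRoot ω t) (hj0 : j ≠ 0) (hjt : j < t) (g : F → F) :
    ∑ a : F, a ^ j * g (a ^ t) = 0 := by
  have hω0 : ω ≠ 0 := hω.ne_zero (by omega)
  have h : ∑ a : F, a ^ j * g (a ^ t) = ω ^ j * ∑ a : F, a ^ j * g (a ^ t) := by
    rw [Finset.mul_sum, ← Equiv.sum_comp (Equiv.mulLeft₀ ω hω0)]
    refine Finset.sum_congr rfl fun a _ => ?_
    simp [mul_pow, hω.pow_eq_one, mul_assoc]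
  by_contra hne
  exact hω.pow_ne_one_of_pos_of_lt hj0 hjt (mul_right_cancel₀ hne (by rw [← h, one_mul]))

/-- The inverse of `z - a` modulo `z ^ t - 1`. -/
theorem inverse_sub_algebraMap {F R : Type*} [Field F] [CommRing R] [Algebra F R] {z : R} {t : ℕ}
    (hz : z ^ t = 1) {a : F} (ha : a ^ t ≠ 1) :
    Ring.inverse (z - algebraMap F R a)
      = ∑ i ∈ Finset.range t, algebraMap F R (a ^ (t - 1 - i) * (1 - a ^ t)⁻¹) * z ^ i := by
  have h : (z - algebraMap F R a) *
      ∑ i ∈ Finset.range t, algebraMap F R (a ^ (t - 1 - i) * (1 - a ^ t)⁻¹) * z ^ i = 1 := by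
    have hg := (Commute.all z (algebraMap F R a)).mul_geom_sum₂ t
    have hs : ∑ i ∈ Finset.range t, algebraMap F R (a ^ (t - 1 - i) * (1 - a ^ t)⁻¹) * z ^ i
        = (∑ i ∈ Finset.range t, z ^ i * algebraMap F R a ^ (t - 1 - i))
          * algebraMap F R (1 - a ^ t)⁻¹ := by
      rw [Finset.sum_mul]
      refine Finset.sum_congr rfl fun i _ => ?_
      rw [map_mul, map_pow]
      ring
    rw [hs, ← mul_assoc, hg, hz, ← map_pow, ← map_one (algebraMap F R), ← map_sub, ← map_mul,
      mul_inv_cancel₀ (sub_ne_zero.2 ha.symm)]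
  rw [← (IsUnit.of_mul_eq_one _ h).mul_right_inj, h, Ring.mul_inverse_cancel _
    (IsUnit.of_mul_eq_one _ h)]

/-- Number of nonzero elements that are not `t`-th roots of unity. -/
theorem card_ne_zero_pow_ne_one {F : Type*} [Field F] [Fintype F] [DecidableEq F] {ω : F} {t : ℕ}
    (ht : 0 < t) (hω : IsPrimitiveRoot ω t) :
    (Finset.univ.filter (fun a : F => a ≠ 0 ∧ a ^ t ≠ 1)).card = Fintype.card F - t - 1 := by
  have h : Finset.univ.filter (fun a : F => a ≠ 0 ∧ a ^ t ≠ 1)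
      = (insert 0 (nthRootsFinset t (1 : F)))ᶜ := by
    ext a
    simp [mem_nthRootsFinset ht]
  have h0 : (0 : F) ∉ nthRootsFinset t (1 : F) := by
    simp [mem_nthRootsFinset ht, ht.ne']
  rw [h, Finset.card_compl, Finset.card_insert_of_notMem h0, hω.card_nthRootsFinset,
    Nat.sub_add_eq]

/-- In characteristic two, the sum of `(z - a)⁻¹` over `a ≠ 0`, `a ^ t ≠ 1` vanishes. -/
theorem sum_inverse_sub_algebraMap_eq_zero {F R : Type*} [Field F] [Fintype F] [DecidableEq F]
    [CharP F 2] [CommRing R] [Algebra F R] {z : R} {t l : ℕ} (hz : z ^ t = 1) {α : F}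
    (hα : IsPrimitiveRoot α (Fintype.card F - 1)) (hlt : Fintype.card F - 1 = l * t)
    (hS : (∑ μ ∈ Finset.Icc 1 (l - 1), (α ^ (μ * t) + 1)⁻¹) = 0) :
    ∑ a ∈ Finset.univ.filter (fun a : F => a ≠ 0 ∧ a ^ t ≠ 1),
      Ring.inverse (z - algebraMap F R a) = 0 := by
  have hN : 0 < l * t := hlt ▸ Nat.sub_pos_of_lt Fintype.one_lt_card
  have hl0 : 0 < l := Nat.pos_of_mul_pos_right hN
  have hω : IsPrimitiveRoot (α ^ l) t := hα.pow (hlt ▸ hN) hlt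
  have hcoeff : ∀ j < t, ∑ a : F with a ≠ 0, a ^ j * (1 - a ^ t)⁻¹ = 0 := by
    intro j hj
    rcases eq_or_ne j 0 with rfl | hj0
    · have hper : Function.Periodic (fun k : ℕ => (1 - (α ^ k) ^ t)⁻¹) l := by
        intro k
        simp only [pow_add, mul_pow, hω.pow_eq_one, mul_one]
      have hrange : ∑ k ∈ Finset.range l, (1 - (α ^ k) ^ t)⁻¹ = 0 := by
        obtain ⟨n, rfl⟩ := Nat.exists_eq_succ_of_ne_zero hl0.ne'
        rw [Finset.range_eq_Ico, Finset.sum_eq_sum_Ico_succ_bot n.succ_pos]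
        simp only [pow_zero, one_pow, sub_self, inv_zero, zero_add]
        rw [← hS]
        refine Finset.sum_congr (by ext; simp [Nat.succ_le_iff]) fun μ _ => ?_
        rw [CharTwo.sub_eq_add, pow_mul, add_comm]
      simp only [pow_zero, one_mul]
      rw [sum_ne_zero_eq_sum_range_pow hα, hlt, sum_range_mul_of_periodic hper, hrange, smul_zero]
    · rw [Finset.sum_filter_of_ne]
      · exact sum_pow_mul_eq_zero hω hj0 hj fun x => (1 - x)⁻¹
      · rintro a - h rfl
        simp [hj0] at h
  have hfilter : ∀ j < t,
      ∑ a ∈ Finset.univ.filter (fun a : F => a ≠ 0 ∧ a ^ t ≠ 1), a ^ j * (1 - a ^ t)⁻¹ = 0 := by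
    intro j hj
    rw [← Finset.filter_filter, Finset.sum_filter_of_ne, hcoeff j hj]
    intro a _ h h1
    simp [h1] at h
  rw [Finset.sum_congr rfl fun a ha =>
    inverse_sub_algebraMap hz (Finset.mem_filter.1 ha).2.2, Finset.sum_comm]
  refine Finset.sum_eq_zero fun i hi => ?_
  have hit := Finset.mem_range.1 hi
  rw [← Finset.sum_mul, ← map_sum, hfilter _ (by omega), map_zero, zero_mul]

/-- Let `α` be a primitive element of `𝔽_{2^m}`, `t ∣ 2^m - 1` a positive divisor,
`l = (2^m-1)/t`, and suppose `S = ∑_{μ=1}^{l-1} (α^{μt}+1)⁻¹ = 0`.  Let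
`L = {a ∈ 𝔽_{2^m} : a ≠ 0, a^t ≠ 1}` (so `|L| = 2^m - t - 1`).  Then
`∑_{a ∈ L} (z - a)⁻¹ = 0` in `𝔽_{2^m}[z]/(z^t + 1)`; i.e. the all-ones vector is a
codeword of the binary Goppa code `Γ(L, z^t + 1)`. -/
theorem allOnes_mem_goppa_of_S_eq_zero
    (m : ℕ) (hm : 1 ≤ m)
    (F : Type) [Field F] [Fintype F] [DecidableEq F] (hcard : Fintype.card F = 2 ^ m)
    (α : F) (hα : ∀ x : F, x ≠ 0 → ∃ k : ℕ, x = α ^ k)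
    (t l : ℕ) (ht : 0 < t) (htdvd : t ∣ 2 ^ m - 1) (hl : l = (2 ^ m - 1) / t)
    (hS : (∑ μ ∈ Finset.Icc 1 (l - 1), (α ^ (μ * t) + 1)⁻¹) = 0) :
    ({a : F | a ≠ 0 ∧ a ^ t ≠ 1} : Set F).ncard = 2 ^ m - t - 1 ∧
    ∑ a ∈ Finset.univ.filter (fun a : F => a ≠ 0 ∧ a ^ t ≠ 1),
        Ring.inverse (Ideal.Quotient.mk (Ideal.span {(X ^ t + 1 : F[X])}) (X - C a))
      = 0 := by
  have : CharP F 2 := charP_of_card_eq_prime_pow hcard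
  obtain ⟨β, hβ, hSβ⟩ : ∃ β : F, IsPrimitiveRoot β (Fintype.card F - 1) ∧
      ∑ μ ∈ Finset.Icc 1 (l - 1), (β ^ (μ * t) + 1)⁻¹ = 0 := by
    by_cases h0 : α = 0
    · have hone : ∀ u : Fˣ, u = 1 := by
        intro u
        obtain ⟨k, hk⟩ := hα u u.ne_zero
        rcases eq_or_ne k 0 with rfl | hk0
        · rw [pow_zero] at hk
          exact Units.ext hk
        · simp [h0, hk0] at hk
      have hc : Fintype.card F - 1 = 1 := by
        rw [← Fintype.card_units]
        exact Fintype.card_eq_one_iff.2 ⟨1, hone⟩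
      refine ⟨1, hc.symm ▸ IsPrimitiveRoot.one, ?_⟩
      have hl1 : l ≤ 1 := by
        rw [hl, ← hcard, hc]
        exact Nat.div_le_self 1 t
      simp [Nat.sub_eq_zero_of_le hl1]
    · exact ⟨α, isPrimitiveRoot_of_forall_eq_pow h0 hα, hS⟩
  have hlt : Fintype.card F - 1 = l * t := by
    rw [hcard, hl, Nat.div_mul_cancel htdvd]
  have hω : IsPrimitiveRoot (β ^ l) t :=
    hβ.pow (Nat.sub_pos_of_lt Fintype.one_lt_card) hlt
  constructor
  · rw [← hcard, ← card_ne_zero_pow_ne_one ht hω, ← Set.ncard_coe_finset]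
    simp
  · have hz : (Ideal.Quotient.mk (Ideal.span {(X ^ t + 1 : F[X])}) X) ^ t = 1 := by
      rw [← map_pow, ← map_one (Ideal.Quotient.mk _), Ideal.Quotient.eq, CharTwo.sub_eq_add]
      exact Ideal.mem_span_singleton_self _
    simp only [map_sub]
    exact sum_inverse_sub_algebraMap_eq_zero hz hβ hlt hSβ
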